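/- arXiv:1710.07523 — 4 statements merged into one kernel-verified Lean document; each statement's English description precedes it below -/
import Mathlib

section
/- The element w = xy − qyx is central in B, satisfies xw = wx = yw = wy = 0 and w² = 0, and the two-sided ideal of B generated by w is one-dimensional over k, equal to the k-span of w. -/
noncomputable section
open FreeAlgebra Matrix

/-- The defining relations of `B = k⟨x,y⟩/(x², y², xyx, yxy)`. -/
inductive BRel (k : Type*) [Field k] : FreeAlgebra k (Fin 2) → FreeAlgebra k (Fin 2) → Prop
  | xx : BRel k (ι k 0 * ι k 0) 0
  | yy : BRel k (ι k 1 * ι k 1) 0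
  | xyx : BRel k (ι k 0 * ι k 1 * ι k 0) 0
  | yxy : BRel k (ι k 1 * ι k 0 * ι k 1) 0

/-- The algebra `B = k⟨x,y⟩/(x², y², xyx, yxy)`. -/
abbrev B (k : Type*) [Field k] := RingQuot (BRel k)

/-- The image of the generator `x` in `B`. -/
def Bx (k : Type*) [Field k] : B k := RingQuot.mkAlgHom k (BRel k) (ι k 0)

/-- The image of the generator `y` in `B`. -/
def By (k : Type*) [Field k] : B k := RingQuot.mkAlgHom k (BRel k) (ι k 1)

/-- The element `w = xy - q·yx` of `B`. -/
def wB (k : Type*) [Field k] (q : k) : B k := Bx k * By k - q • (By k * Bx k)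

theorem Bx_mul_Bx (k : Type*) [Field k] : Bx k * Bx k = 0 := by
  simpa [Bx] using RingQuot.mkAlgHom_rel k (BRel.xx (k := k))

theorem By_mul_By (k : Type*) [Field k] : By k * By k = 0 := by
  simpa [By] using RingQuot.mkAlgHom_rel k (BRel.yy (k := k))

theorem Bx_mul_By_mul_Bx (k : Type*) [Field k] : Bx k * By k * Bx k = 0 := by
  simpa [Bx, By] using RingQuot.mkAlgHom_rel k (BRel.xyx (k := k))

theorem By_mul_Bx_mul_By (k : Type*) [Field k] : By k * Bx k * By k = 0 := by
  simpa [Bx, By] using RingQuot.mkAlgHom_rel k (BRel.yxy (k := k))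

theorem Bx_mul_wB (k : Type*) [Field k] (q : k) : Bx k * wB k q = 0 := by
  simp [wB, mul_sub, ← mul_assoc, Bx_mul_Bx, Bx_mul_By_mul_Bx]

theorem wB_mul_Bx (k : Type*) [Field k] (q : k) : wB k q * Bx k = 0 := by
  simp [wB, sub_mul, mul_assoc (By k), Bx_mul_Bx, Bx_mul_By_mul_Bx]

theorem By_mul_wB (k : Type*) [Field k] (q : k) : By k * wB k q = 0 := by
  simp [wB, mul_sub, ← mul_assoc, By_mul_By, By_mul_Bx_mul_By]

theorem wB_mul_By (k : Type*) [Field k] (q : k) : wB k q * By k = 0 := by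
  simp [wB, sub_mul, mul_assoc (Bx k), By_mul_By, By_mul_Bx_mul_By]

/-- Every element of `B` acts on `w` from both sides by one and the same scalar. -/
theorem exists_mul_wB_eq_smul (k : Type*) [Field k] (q : k) (b : B k) :
    ∃ c : k, b * wB k q = c • wB k q ∧ wB k q * b = c • wB k q := by
  obtain ⟨a, rfl⟩ := RingQuot.mkAlgHom_surjective k (BRel k) b
  induction a using FreeAlgebra.induction with
  | grade0 r =>
    refine ⟨r, ?_, ?_⟩
    · rw [AlgHom.commutes, Algebra.smul_def]
    · rw [AlgHom.commutes, Algebra.smul_def, Algebra.commutes]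
  | grade1 i =>
    refine ⟨0, ?_⟩
    rw [zero_smul]
    fin_cases i
    · exact ⟨Bx_mul_wB k q, wB_mul_Bx k q⟩
    · exact ⟨By_mul_wB k q, wB_mul_By k q⟩
  | mul a b ha hb =>
    obtain ⟨c, hc, hc'⟩ := ha
    obtain ⟨d, hd, hd'⟩ := hb
    refine ⟨c * d, ?_, ?_⟩
    · rw [map_mul, mul_assoc, hd, mul_smul_comm, hc, smul_smul, mul_comm]
    · rw [map_mul, ← mul_assoc, hc', smul_mul_assoc, hd', smul_smul]
  | add a b ha hb =>
    obtain ⟨c, hc, hc'⟩ := ha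
    obtain ⟨d, hd, hd'⟩ := hb
    exact ⟨c + d, by rw [map_add, add_mul, hc, hd, add_smul],
      by rw [map_add, mul_add, hc', hd', add_smul]⟩

theorem wB_ne_zero (k : Type*) [Field k] (q : k) : wB k q ≠ 0 := by
  let g : FreeAlgebra k (Fin 2) →ₐ[k] Matrix (Fin 3) (Fin 3) k :=
    FreeAlgebra.lift k ![Matrix.single 0 1 1, Matrix.single 1 2 1]
  have hg : ∀ ⦃a b⦄, BRel k a b → g a = g b := by
    intro a b h
    cases h <;> simp [g]
  let f : B k →ₐ[k] Matrix (Fin 3) (Fin 3) k := RingQuot.liftAlgHom k ⟨g, hg⟩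
  have hx : f (Bx k) = Matrix.single 0 1 1 := by
    simp [f, g, Bx]
  have hy : f (By k) = Matrix.single 1 2 1 := by
    simp [f, g, By]
  intro h
  have hw : f (wB k q) = Matrix.single 0 2 1 := by
    simp [wB, hx, hy]
  rw [h, map_zero] at hw
  simpa using congrFun (congrFun hw 0) 2

theorem stmt0 (k : Type*) [Field k] (q : k) (hq : q ≠ 0) :
    (∀ b : B k, b * wB k q = wB k q * b) ∧
    Bx k * wB k q = 0 ∧ wB k q * Bx k = 0 ∧
    By k * wB k q = 0 ∧ wB k q * By k = 0 ∧
    wB k q * wB k q = 0 ∧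
    wB k q ≠ 0 ∧
    ((TwoSidedIdeal.span {wB k q} : TwoSidedIdeal (B k)) : Set (B k)) =
      {z : B k | ∃ c : k, z = c • wB k q} := by
  refine ⟨fun b => ?_, Bx_mul_wB k q, wB_mul_Bx k q, By_mul_wB k q, wB_mul_By k q, ?_,
    wB_ne_zero k q, ?_⟩
  · obtain ⟨c, hc, hc'⟩ := exists_mul_wB_eq_smul k q b
    rw [hc, hc']
  · conv_lhs => enter [2]; rw [wB]
    rw [mul_sub, mul_smul_comm, ← mul_assoc, ← mul_assoc, wB_mul_Bx, wB_mul_By]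
    simp
  · apply Set.Subset.antisymm
    · let I : TwoSidedIdeal (B k) := TwoSidedIdeal.mk' {z : B k | ∃ c : k, z = c • wB k q}
        ⟨0, (zero_smul k _).symm⟩
        (by rintro _ _ ⟨c, rfl⟩ ⟨d, rfl⟩; exact ⟨c + d, (add_smul c d _).symm⟩)
        (by rintro _ ⟨c, rfl⟩; exact ⟨-c, (neg_smul c _).symm⟩)
        (by
          rintro b _ ⟨c, rfl⟩
          obtain ⟨d, hd, -⟩ := exists_mul_wB_eq_smul k q b
          exact ⟨c * d, by rw [mul_smul_comm, hd, smul_smul]⟩)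
        (by
          rintro _ b ⟨c, rfl⟩
          obtain ⟨d, -, hd⟩ := exists_mul_wB_eq_smul k q b
          exact ⟨c * d, by rw [smul_mul_assoc, hd, smul_smul]⟩)
      have hI : TwoSidedIdeal.span {wB k q} ≤ I := by
        rw [TwoSidedIdeal.span_le, Set.singleton_subset_iff]
        exact (TwoSidedIdeal.mem_mk' ..).2 ⟨1, (one_smul k _).symm⟩
      intro z hz
      exact (TwoSidedIdeal.mem_mk' ..).1 (hI hz)
    · rintro _ ⟨c, rfl⟩
      rw [Algebra.smul_def]
      exact TwoSidedIdeal.mul_mem_left _ _ _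
        (TwoSidedIdeal.subset_span (Set.mem_singleton _))
end
end

section
/- Let α ∈ k be nonzero and β₁, β₂, γ₁, γ₂ ∈ k. If the equations (αβ₁x + α⁻¹β₂y)(γ₁x + γ₂y) = w and (γ₁x + γ₂y)(β₁x + β₂y) = w hold in B, then β₁, β₂, γ₁, γ₂ are all nonzero and α = −q⁻¹. In other words, among the automorphisms μ of B with μ(x) = αx and μ(y) = α⁻¹y, only μ = ν admits a rank-one twisted matrix factorization of w with maps given by right multiplication by β₁x + β₂y and γ₁x + γ₂y. -/
noncomputable section
open FreeAlgebra Matrix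

/-- Elements of a `k`-algebra satisfying the relations of `B` are the images of the generators
under an algebra homomorphism. -/
theorem exists_algHom_B {k A : Type*} [Field k] [Ring A] [Algebra k A] (a b : A)
    (haa : a * a = 0) (hbb : b * b = 0) (haba : a * b * a = 0) (hbab : b * a * b = 0) :
    ∃ f : B k →ₐ[k] A, f (Bx k) = a ∧ f (By k) = b := by
  have h : ∀ ⦃u v : FreeAlgebra k (Fin 2)⦄, BRel k u v →
      FreeAlgebra.lift k ![a, b] u = FreeAlgebra.lift k ![a, b] v := by
    rintro u v (_ | _ | _ | _) <;> simp [haa, hbb, haba, hbab]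
  refine ⟨RingQuot.liftAlgHom k ⟨FreeAlgebra.lift k ![a, b], h⟩, ?_, ?_⟩ <;>
    simp [Bx, By]

/-- Comparison of the coefficients of `xy` and `yx` in a product of two linear forms equal
to `wB k q`. -/
theorem coeff_of_mul_eq_wB {k : Type*} [Field k] {q a b c d : k}
    (h : (a • Bx k + b • By k) * (c • Bx k + d • By k) = wB k q) :
    a * d = 1 ∧ b * c = -q := by
  let X : Matrix (Fin 3) (Fin 3) k := single 0 1 1
  let Y : Matrix (Fin 3) (Fin 3) k := single 1 2 1
  have hXX : X * X = 0 := by simp [X]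
  have hYY : Y * Y = 0 := by simp [Y]
  have hXY : X * Y = single 0 2 1 := by simp [X, Y]
  have hYX : Y * X = 0 := by simp [X, Y]
  have hXYX : X * Y * X = 0 := by rw [mul_assoc, hYX, mul_zero]
  have hYXY : Y * X * Y = 0 := by rw [hYX, zero_mul]
  obtain ⟨f, hfx, hfy⟩ := exists_algHom_B (k := k) X Y hXX hYY hXYX hYXY
  obtain ⟨g, hgx, hgy⟩ := exists_algHom_B (k := k) Y X hYY hXX hYXY hXYX
  have hf := congrFun₂ (congrArg f h) 0 2
  have hg := congrFun₂ (congrArg g h) 0 2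
  simp [wB, hfx, hfy, add_mul, mul_add, hXX, hYY, hXY, hYX] at hf
  simp [wB, hgx, hgy, add_mul, mul_add, hXX, hYY, hXY, hYX] at hg
  constructor
  · linear_combination hf
  · linear_combination hg

theorem stmt7 (k : Type*) [Field k] (q : k) (hq : q ≠ 0)
    (α β1 β2 γ1 γ2 : k) (hα : α ≠ 0)
    (h1 : ((α * β1) • Bx k + (α⁻¹ * β2) • By k) * (γ1 • Bx k + γ2 • By k) = wB k q)
    (h2 : (γ1 • Bx k + γ2 • By k) * (β1 • Bx k + β2 • By k) = wB k q) :
    β1 ≠ 0 ∧ β2 ≠ 0 ∧ γ1 ≠ 0 ∧ γ2 ≠ 0 ∧ α = -q⁻¹ := by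
  obtain ⟨h11, h12⟩ := coeff_of_mul_eq_wB h1
  obtain ⟨h21, h22⟩ := coeff_of_mul_eq_wB h2
  refine ⟨?_, ?_, ?_, ?_, ?_⟩
  · rintro rfl
    simp at h11
  · rintro rfl
    simp at h21
  · rintro rfl
    simp at h21
  · rintro rfl
    simp at h11
  · field_simp
    linear_combination α * h22 - h11
end
end

section
/- Let C = xC₁ + yC₂ + xyC₃ + yxC₄ and D = xD₁ + yD₂ + xyD₃ + yxD₄ be r×r matrices over B, where the Cᵢ and Dᵢ are r×r matrices over k. If ν(C)D = wI_r, then C₁D₂ = −qI_r and C₂D₁ = I_r; in particular the matrices C₁, C₂, D₁ and D₂ are all invertible over k. -/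
noncomputable section
open FreeAlgebra Matrix

/-- Regard a matrix over `k` as a matrix over `B` via the structure map. -/
def matB (k : Type*) [Field k] {r : ℕ} (M : Matrix (Fin r) (Fin r) k) :
    Matrix (Fin r) (Fin r) (B k) :=
  M.map (algebraMap k (B k))

/-- The algebra homomorphism out of `B` determined by images of `x` and `y` satisfying the
defining relations. -/
def liftB {k A : Type*} [Field k] [Ring A] [Algebra k A] (X Y : A) (hxx : X * X = 0)
    (hyy : Y * Y = 0) (hxyx : X * Y * X = 0) (hyxy : Y * X * Y = 0) : B k →ₐ[k] A :=
  RingQuot.liftAlgHom k ⟨FreeAlgebra.lift k ![X, Y], by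
    rintro _ _ (_ | _ | _ | _) <;> simpa⟩

/-- There is a representation of `B` by strictly upper triangular matrices in which `xy` acts
nontrivially and `yx` acts as zero. -/
lemma exists_rep_xy (k : Type*) [Field k] : ∃ φ : B k →ₐ[k] Matrix (Fin 3) (Fin 3) k,
    φ (Bx k) = !![0, 1, 0; 0, 0, 0; 0, 0, 0] ∧ φ (By k) = !![0, 0, 0; 0, 0, 1; 0, 0, 0] := by
  refine ⟨liftB !![0, 1, 0; 0, 0, 0; 0, 0, 0] !![0, 0, 0; 0, 0, 1; 0, 0, 0] ?_ ?_ ?_ ?_, ?_, ?_⟩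
  iterate 4
    ext i j
    fin_cases i <;> fin_cases j <;> simp [Matrix.mul_apply, Fin.sum_univ_three]
  all_goals simp [liftB, Bx, By]

/-- There is a representation of `B` by strictly upper triangular matrices in which `yx` acts
nontrivially and `xy` acts as zero. -/
lemma exists_rep_yx (k : Type*) [Field k] : ∃ φ : B k →ₐ[k] Matrix (Fin 3) (Fin 3) k,
    φ (Bx k) = !![0, 0, 0; 0, 0, 1; 0, 0, 0] ∧ φ (By k) = !![0, 1, 0; 0, 0, 0; 0, 0, 0] := by
  refine ⟨liftB !![0, 0, 0; 0, 0, 1; 0, 0, 0] !![0, 1, 0; 0, 0, 0; 0, 0, 0] ?_ ?_ ?_ ?_, ?_, ?_⟩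
  iterate 4
    ext i j
    fin_cases i <;> fin_cases j <;> simp [Matrix.mul_apply, Fin.sum_univ_three]
  all_goals simp [liftB, Bx, By]

theorem stmt9 (k : Type*) [Field k] (q : k) (hq : q ≠ 0)
    (ν : B k ≃ₐ[k] B k)
    (hνx : ν (Bx k) = -(q⁻¹ • Bx k)) (hνy : ν (By k) = -(q • By k))
    (r : ℕ) (C1 C2 C3 C4 D1 D2 D3 D4 : Matrix (Fin r) (Fin r) k)
    (C D : Matrix (Fin r) (Fin r) (B k))
    (hC : C = Bx k • matB k C1 + By k • matB k C2 +
        (Bx k * By k) • matB k C3 + (By k * Bx k) • matB k C4)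
    (hD : D = Bx k • matB k D1 + By k • matB k D2 +
        (Bx k * By k) • matB k D3 + (By k * Bx k) • matB k D4)
    (hfact : C.map ⇑ν * D = wB k q • (1 : Matrix (Fin r) (Fin r) (B k))) :
    C1 * D2 = -q • 1 ∧ C2 * D1 = 1 ∧
    IsUnit C1 ∧ IsUnit C2 ∧ IsUnit D1 ∧ IsUnit D2 := by
  have h12 : C1 * D2 = -q • 1 := by
    obtain ⟨φ, hx, hy⟩ := exists_rep_xy k
    ext i l
    have h := congrArg (fun M => φ (M i l) 0 2) hfact
    simp only [hC, hD, Matrix.mul_apply, Matrix.map_apply, Matrix.add_apply, Matrix.smul_apply,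
      smul_eq_mul, matB, map_sum, map_mul, map_add, AlgEquiv.commutes, AlgHom.commutes, hνx, hνy,
      map_neg, map_smul, hx, hy, wB, map_sub, Matrix.sum_apply] at h
    simp [Fin.sum_univ_three, Matrix.algebraMap_matrix_apply] at h
    have h1 : φ ((1 : Matrix (Fin r) (Fin r) (B k)) i l) 2 2 = (1 : Matrix _ _ k) i l := by
      rw [Matrix.one_apply, Matrix.one_apply]
      split_ifs <;> simp
    simp only [h1, mul_assoc, ← Finset.mul_sum, ← Matrix.mul_apply] at h
    rw [Matrix.smul_apply, smul_eq_mul, ← h]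
    field_simp
  have h21 : C2 * D1 = 1 := by
    obtain ⟨φ, hx, hy⟩ := exists_rep_yx k
    ext i l
    have h := congrArg (fun M => φ (M i l) 0 2) hfact
    simp only [hC, hD, Matrix.mul_apply, Matrix.map_apply, Matrix.add_apply, Matrix.smul_apply,
      smul_eq_mul, matB, map_sum, map_mul, map_add, AlgEquiv.commutes, AlgHom.commutes, hνx, hνy,
      map_neg, map_smul, hx, hy, wB, map_sub, Matrix.sum_apply] at h
    simp [Fin.sum_univ_three, Matrix.algebraMap_matrix_apply] at h
    have h1 : φ ((1 : Matrix (Fin r) (Fin r) (B k)) i l) 2 2 = (1 : Matrix _ _ k) i l := by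
      rw [Matrix.one_apply, Matrix.one_apply]
      split_ifs <;> simp
    simp only [h1, mul_assoc, ← Finset.mul_sum, ← Matrix.mul_apply] at h
    exact mul_left_cancel₀ hq h
  have h12' : C1 * (-q⁻¹ • D2) = 1 := by
    rw [Matrix.mul_smul, h12, smul_smul, neg_mul_neg, inv_mul_cancel₀ hq, one_smul]
  have h12'' : (-q⁻¹ • C1) * D2 = 1 := by
    rw [Matrix.smul_mul, h12, smul_smul, neg_mul_neg, inv_mul_cancel₀ hq, one_smul]
  exact ⟨h12, h21, .of_mul_eq_one _ h12', .of_mul_eq_one _ h21, .of_mul_eq_one_right _ h21,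
    .of_mul_eq_one_right _ h12''⟩
end
end

section
/- Let C be an invertible n×n matrix over k and C', C'' arbitrary n×n matrices over k. Let φ : Aⁿ → Aⁿ be the left A-linear map given by right multiplication of row vectors by the matrix x̄I_n + ȳC + x̄ȳC' + ȳx̄C'' (where x̄, ȳ are the images of x, y in A). Then the image M of φ is a left A-module with dim_k M = 2n, and M is isomorphic as a left A-module to the module with underlying vector space k^{2n} on which x acts by the 2n×2n block matrix [[0, qC],[0, 0]] and y acts by [[0, I_n],[0, 0]]. -/
noncomputable section
open FreeAlgebra Matrix

set_option maxSynthPendingDepth 3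

/-- The relation generating the two-sided ideal `(w)` of `B`. -/
inductive ARel (k : Type*) [Field k] (q : k) : B k → B k → Prop
  | w : ARel k q (wB k q) 0

/-- The quantum complete intersection `A = B/(w)`. -/
abbrev Aalg (k : Type*) [Field k] (q : k) := RingQuot (ARel k q)

/-- The quotient map `B → A = B/(w)`. -/
def piA (k : Type*) [Field k] (q : k) : B k →ₐ[k] Aalg k q :=
  RingQuot.mkAlgHom k (ARel k q)

/-- The image of `x` in `A`. -/
def Ax (k : Type*) [Field k] (q : k) : Aalg k q := piA k q (Bx k)

/-- The image of `y` in `A`. -/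
def Ay (k : Type*) [Field k] (q : k) : Aalg k q := piA k q (By k)

/-- Regard a matrix over `k` as a matrix over `A` via the structure map. -/
def matA (k : Type*) [Field k] (q : k) {r : ℕ} (M : Matrix (Fin r) (Fin r) k) :
    Matrix (Fin r) (Fin r) (Aalg k q) :=
  M.map (algebraMap k (Aalg k q))

/-- The matrix `x̄·I + ȳ·C + x̄ȳ·C' + ȳx̄·C''` over `A`. -/
def phiMat (k : Type*) [Field k] (q : k) {n : ℕ} (C C' C'' : Matrix (Fin n) (Fin n) k) :
    Matrix (Fin n) (Fin n) (Aalg k q) :=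
  Ax k q • (1 : Matrix (Fin n) (Fin n) (Aalg k q)) + Ay k q • matA k q C +
    (Ax k q * Ay k q) • matA k q C' + (Ay k q * Ax k q) • matA k q C''

/-- The image (as a `k`-subspace of `Aⁿ`) of right multiplication of row vectors by a
matrix `M` over `A`; this map is left `A`-linear, so its image is in particular a
`k`-subspace. -/
def imageM (k : Type*) [Field k] (q : k) {n : ℕ} (M : Matrix (Fin n) (Fin n) (Aalg k q)) :
    Submodule k (Fin n → Aalg k q) :=
  Submodule.span k (Set.range fun u : Fin n → Aalg k q => u ᵥ* M)

open Polynomial in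
/-- A quotient of `k[X]` by a nonzero polynomial is a Frobenius algebra. -/
theorem exists_frobenius_functional {k : Type*} [Field k] {f : k[X]} (hf : f ≠ 0) :
    ∃ l : (k[X] ⧸ Ideal.span {f}) →ₗ[k] k, ∀ a, (∀ r, l (a * r) = 0) → a = 0 := by
  classical
  have hspan : Ideal.span {f} = Ideal.span {normalize f} :=
    (Ideal.span_singleton_eq_span_singleton.2 (normalize_associated f)).symm
  rw [hspan]
  have hg : (normalize f).Monic := monic_normalize hf
  generalize normalize f = g at hg
  refine ⟨lcoeff k (g.natDegree - 1) ∘ₗ AdjoinRoot.modByMonicHom hg, fun a ha => ?_⟩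
  obtain ⟨p, rfl⟩ := AdjoinRoot.mk_surjective (g := g) a
  by_contra hne
  have hr : p %ₘ g ≠ 0 := fun h => hne (AdjoinRoot.mk_eq_zero.2
    ((modByMonic_eq_zero_iff_dvd hg).1 h))
  have hdeg : (p %ₘ g).natDegree < g.natDegree :=
    natDegree_lt_natDegree hr (degree_modByMonic_lt p hg)
  have hmk : AdjoinRoot.mk g p = AdjoinRoot.mk g (p %ₘ g) := by
    rw [AdjoinRoot.mk_eq_mk]
    exact ⟨p /ₘ g, by rw [sub_eq_iff_eq_add', modByMonic_add_div p g]⟩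
  set r := p %ₘ g
  have key : lcoeff k (g.natDegree - 1) (AdjoinRoot.modByMonicHom hg (AdjoinRoot.mk g p *
      AdjoinRoot.mk g (X ^ (g.natDegree - 1 - r.natDegree)))) = 0 :=
    ha (AdjoinRoot.mk g (X ^ (g.natDegree - 1 - r.natDegree)))
  have hred : (r * X ^ (g.natDegree - 1 - r.natDegree)) %ₘ g
      = r * X ^ (g.natDegree - 1 - r.natDegree) := by
    rw [modByMonic_eq_self_iff hg]
    apply degree_lt_degree
    rw [natDegree_mul_X_pow _ hr]
    omega
  have hexp : g.natDegree - 1 = r.natDegree + (g.natDegree - 1 - r.natDegree) := by omega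
  rw [hmk, ← map_mul, AdjoinRoot.modByMonicHom_mk, hred, lcoeff_apply] at key
  have hco := coeff_mul_X_pow r (g.natDegree - 1 - r.natDegree) r.natDegree
  rw [← hexp, key, eq_comm, coeff_natDegree, leadingCoeff_eq_zero] at hco
  exact hr hco

open Polynomial in
/-- Every endomorphism of a finite-dimensional space is self-adjoint for some bilinear form with
trivial left kernel. -/
theorem exists_selfAdjoint_bilinForm {k V : Type*} [Field k] [AddCommGroup V] [Module k V]
    [FiniteDimensional k V] (T : Module.End k V) :
    ∃ b : V →ₗ[k] V →ₗ[k] k, (∀ u, (∀ v, b u v = 0) → u = 0) ∧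
      ∀ u v, b (T u) v = b u (T v) := by
  classical
  obtain ⟨ι, _, p, hp, d, ⟨e⟩⟩ := Module.equiv_directSum_of_isTorsion
    (R := k[X]) (M := Module.AEval' T) (Module.AEval.isTorsion_of_finiteDimensional k V T)
  have hpd : ∀ i, p i ^ d i ≠ 0 := fun i => pow_ne_zero _ (hp i).ne_zero
  choose l hl using fun i => exists_frobenius_functional (hpd i)
  let c (i : ι) : V →ₗ[k] (k[X] ⧸ Ideal.span {p i ^ d i}) :=
    ((DirectSum.component k[X] ι (fun i => k[X] ⧸ Ideal.span {p i ^ d i}) i ∘ₗ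
      e.toLinearMap).restrictScalars k) ∘ₗ (Module.AEval'.of T).toLinearMap
  have hcT (i : ι) (v : V) : c i (T v) = Ideal.Quotient.mk _ X * c i v := by
    have : Module.AEval'.of T (T v) = (X : k[X]) • Module.AEval'.of T v :=
      (Module.AEval'.X_smul_of T v).symm
    simp only [c, LinearMap.comp_apply, LinearEquiv.coe_coe, LinearMap.restrictScalars_apply, this,
      map_smul]
    exact Algebra.smul_def _ _
  have hc (i : ι) (v : V) : c i v = e (Module.AEval'.of T v) i := rfl
  refine ⟨∑ i, ((LinearMap.mul k _).compr₂ (l i)).compl₁₂ (c i) (c i), fun u hu => ?_,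
    fun u v => ?_⟩
  · have hz : e (Module.AEval'.of T u) = 0 := by
      refine DFinsupp.ext fun i => ?_
      refine hl i (e (Module.AEval'.of T u) i) fun r => ?_
      have := hu ((Module.AEval'.of T).symm (e.symm (DirectSum.of _ i r)))
      simp only [LinearMap.sum_apply] at this
      rw [Finset.sum_eq_single i] at this
      · simpa [hc] using this
      · intro j _ hj
        simp [hc, DirectSum.of_eq_of_ne _ _ _ hj]
      · simp
    simpa using hz
  · simp only [LinearMap.sum_apply]
    refine Finset.sum_congr rfl fun i _ => ?_
    simp only [LinearMap.compl₁₂_apply, LinearMap.compr₂_apply, LinearMap.mul_apply', hcT]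
    congr 1
    ring

/-- Every square matrix over a field is similar to its transpose. -/
theorem exists_isUnit_transpose_mul_eq_mul {k m : Type*} [Field k] [Fintype m] [DecidableEq m]
    (C : Matrix m m k) : ∃ P : Matrix m m k, IsUnit P ∧ Cᵀ * P = P * C := by
  obtain ⟨b, hb, hbC⟩ := exists_selfAdjoint_bilinForm (Matrix.toLin' C)
  refine ⟨LinearMap.toMatrix₂' k b, ?_, ?_⟩
  · rw [← Matrix.vecMul_injective_iff_isUnit]
    change Function.Injective (Matrix.vecMulLinear (LinearMap.toMatrix₂' k b))
    rw [injective_iff_map_eq_zero]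
    intro u (hu : u ᵥ* LinearMap.toMatrix₂' k b = 0)
    refine hb u fun v => ?_
    have : u ⬝ᵥ LinearMap.toMatrix₂' k b *ᵥ v = 0 := by
      rw [Matrix.dotProduct_mulVec, hu, zero_dotProduct]
    rwa [← Matrix.toLinearMap₂'_apply', Matrix.toLinearMap₂'_toMatrix'] at this
  · refine (isAdjointPair_toLinearMap₂' _ _ _ _).1 ?_
    rwa [Matrix.toLinearMap₂'_toMatrix']

section Relations

variable (k : Type*) [Field k] (q : k)

theorem Ax_mul_Ax : Ax k q * Ax k q = 0 := by
  have h : Bx k * Bx k = 0 := by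
    simpa [Bx] using RingQuot.mkAlgHom_rel k (BRel.xx (k := k))
  rw [Ax, ← map_mul, h, map_zero]

theorem Ay_mul_Ay : Ay k q * Ay k q = 0 := by
  have h : By k * By k = 0 := by
    simpa [By] using RingQuot.mkAlgHom_rel k (BRel.yy (k := k))
  rw [Ay, ← map_mul, h, map_zero]

theorem Ax_mul_Ay : Ax k q * Ay k q = q • (Ay k q * Ax k q) := by
  have h : piA k q (wB k q) = piA k q 0 := RingQuot.mkAlgHom_rel k (ARel.w (k := k) (q := q))
  rw [wB, map_zero, map_sub, map_smul, map_mul, map_mul, sub_eq_zero] at h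
  exact h

theorem Ax_mul_Ay_mul_Ax : Ax k q * (Ay k q * Ax k q) = 0 := by
  rw [← mul_assoc, Ax_mul_Ay, smul_mul_assoc, mul_assoc, Ax_mul_Ax, mul_zero, smul_zero]

theorem Ay_mul_Ay_mul_Ax : Ay k q * (Ay k q * Ax k q) = 0 := by
  rw [← mul_assoc, Ay_mul_Ay, zero_mul]

theorem Ay_mul_Ax_mul_Ax : Ay k q * Ax k q * Ax k q = 0 := by
  rw [mul_assoc, Ax_mul_Ax, mul_zero]

theorem Ay_mul_Ax_mul_Ay : Ay k q * Ax k q * Ay k q = 0 := by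
  rw [mul_assoc, Ax_mul_Ay, mul_smul_comm, Ay_mul_Ay_mul_Ax, smul_zero]

/-- The elements `1, x, y, yx` span `A`. -/
theorem Aalg.exists_coeffs (u : Aalg k q) : ∃ a b c d : k,
    u = a • 1 + b • Ax k q + c • Ay k q + d • (Ay k q * Ax k q) := by
  obtain ⟨v, rfl⟩ := RingQuot.mkAlgHom_surjective k (ARel k q) u
  obtain ⟨w, rfl⟩ := RingQuot.mkAlgHom_surjective k (BRel k) v
  induction w using FreeAlgebra.induction with
  | grade0 r => exact ⟨r, 0, 0, 0, by simp [Algebra.algebraMap_eq_smul_one]⟩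
  | grade1 i =>
    fin_cases i
    · exact ⟨0, 1, 0, 0, by simp [Ax, Bx, piA]⟩
    · exact ⟨0, 0, 1, 0, by simp [Ay, By, piA]⟩
  | mul s t hs ht =>
    obtain ⟨a, b, c, d, h⟩ := hs
    obtain ⟨a', b', c', d', h'⟩ := ht
    refine ⟨a * a', a * b' + b * a', a * c' + c * a',
      a * d' + d * a' + q * b * c' + c * b', ?_⟩
    rw [map_mul, map_mul, h, h']
    simp only [mul_add, add_mul, smul_mul_assoc, mul_smul_comm, one_mul, mul_one, Ax_mul_Ax,
      Ay_mul_Ay, Ax_mul_Ay_mul_Ax, Ay_mul_Ay_mul_Ax, Ay_mul_Ax_mul_Ax, Ay_mul_Ax_mul_Ay,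
      Ax_mul_Ay, ← mul_assoc (Ay k q * Ax k q), zero_mul, smul_zero]
    module
  | add s t hs ht =>
    obtain ⟨a, b, c, d, h⟩ := hs
    obtain ⟨a', b', c', d', h'⟩ := ht
    refine ⟨a + a', b + b', c + c', d + d', ?_⟩
    rw [map_add, map_add, h, h']
    module

/-- The left regular representation of `A` in the basis `1, x, y, yx`. -/
def regularRep : Aalg k q →ₐ[k] Matrix (Fin 4) (Fin 4) k :=
  RingQuot.liftAlgHom k ⟨RingQuot.liftAlgHom k ⟨FreeAlgebra.lift k
    ![!![0, 0, 0, 0; 1, 0, 0, 0; 0, 0, 0, 0; 0, 0, q, 0],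
      !![0, 0, 0, 0; 0, 0, 0, 0; 1, 0, 0, 0; 0, 1, 0, 0]], by
    rintro _ _ (_ | _ | _ | _) <;> ext i j <;> fin_cases i <;> fin_cases j <;>
      simp [Matrix.mul_apply, Fin.sum_univ_four]⟩, by
    rintro _ _ ⟨⟩
    ext i j
    fin_cases i <;> fin_cases j <;>
      simp [wB, Bx, By]⟩

theorem regularRep_Ax :
    regularRep k q (Ax k q) = !![0, 0, 0, 0; 1, 0, 0, 0; 0, 0, 0, 0; 0, 0, q, 0] := by
  simp [regularRep, Ax, piA, Bx]

theorem regularRep_Ay :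
    regularRep k q (Ay k q) = !![0, 0, 0, 0; 0, 0, 0, 0; 1, 0, 0, 0; 0, 1, 0, 0] := by
  simp [regularRep, Ay, piA, By]

/-- The elements `x, y, yx` of `A` are linearly independent. -/
theorem Aalg.coeffs_eq_zero {b c d : k}
    (h : b • Ax k q + c • Ay k q + d • (Ay k q * Ax k q) = 0) : b = 0 ∧ c = 0 ∧ d = 0 := by
  have h' := congrArg (regularRep k q) h
  simp only [map_add, map_smul, map_mul, map_zero, regularRep_Ax, regularRep_Ay] at h'
  refine ⟨?_, ?_, ?_⟩
  · simpa [Matrix.mul_apply, Fin.sum_univ_four] using congrFun (congrFun h' 1) 0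
  · simpa [Matrix.mul_apply, Fin.sum_univ_four] using congrFun (congrFun h' 2) 0
  · simpa [Matrix.mul_apply, Fin.sum_univ_four] using congrFun (congrFun h' 3) 0

end Relations

section Image

variable {k : Type*} [Field k] (q : k) {n : ℕ}

/-- The linear map sending `(u, v)` to the vector `a x + (aC) y + e yx` of `Aⁿ`, where `a = Pv`
and `e = Pu`. -/
def imageParam (C P : Matrix (Fin n) (Fin n) k) :
    (Fin n ⊕ Fin n → k) →ₗ[k] (Fin n → Aalg k q) where
  toFun v i := (P *ᵥ (v ∘ Sum.inr)) i • Ax k q + ((P *ᵥ (v ∘ Sum.inr)) ᵥ* C) i • Ay k q +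
    (P *ᵥ (v ∘ Sum.inl)) i • (Ay k q * Ax k q)
  map_add' v w := by
    ext i
    have h (s : Fin n → Fin n ⊕ Fin n) : (v + w) ∘ s = v ∘ s + w ∘ s := rfl
    simp only [h, Matrix.mulVec_add, Matrix.add_vecMul, Pi.add_apply]
    module
  map_smul' r v := by
    ext i
    have h (s : Fin n → Fin n ⊕ Fin n) : (r • v) ∘ s = r • (v ∘ s) := rfl
    simp only [h, Matrix.mulVec_smul, Matrix.smul_vecMul, Pi.smul_apply, RingHom.id_apply]
    module

theorem imageParam_apply (C P : Matrix (Fin n) (Fin n) k) (v : Fin n ⊕ Fin n → k) (i : Fin n) :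
    imageParam q C P v i =
      (P *ᵥ (v ∘ Sum.inr)) i • Ax k q + ((P *ᵥ (v ∘ Sum.inr)) ᵥ* C) i • Ay k q +
        (P *ᵥ (v ∘ Sum.inl)) i • (Ay k q * Ax k q) := rfl

theorem imageParam_injective (C : Matrix (Fin n) (Fin n) k) {P : Matrix (Fin n) (Fin n) k}
    (hP : IsUnit P) : Function.Injective (imageParam q C P) := by
  rw [injective_iff_map_eq_zero]
  intro v hv
  have h i := Aalg.coeffs_eq_zero k q (congrFun hv i)
  have hinj := Matrix.mulVec_injective_iff_isUnit.2 hP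
  have hr : v ∘ Sum.inr = 0 := hinj ((funext fun i => (h i).1).trans (Matrix.mulVec_zero P).symm)
  have hl : v ∘ Sum.inl = 0 := hinj ((funext fun i => (h i).2.2).trans (Matrix.mulVec_zero P).symm)
  ext (i | i)
  exacts [congrFun hl i, congrFun hr i]

theorem phiMat_apply (C C' C'' : Matrix (Fin n) (Fin n) k) (i j : Fin n) :
    phiMat k q C C' C'' i j = (1 : Matrix (Fin n) (Fin n) k) i j • Ax k q + C i j • Ay k q +
      (q * C' i j + C'' i j) • (Ay k q * Ax k q) := by
  simp only [phiMat, matA, Matrix.add_apply, Matrix.smul_apply, Matrix.map_apply, smul_eq_mul,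
    Algebra.algebraMap_eq_smul_one, mul_smul_comm, mul_one, Ax_mul_Ay, Matrix.one_apply]
  split_ifs <;> simp only [mul_one, mul_zero] <;> module

theorem vecMul_phiMat (C C' C'' : Matrix (Fin n) (Fin n) k) (a b c d : Fin n → k) (j : Fin n) :
    ((fun i => a i • 1 + b i • Ax k q + c i • Ay k q + d i • (Ay k q * Ax k q)) ᵥ*
      phiMat k q C C' C'') j = a j • Ax k q + (a ᵥ* C) j • Ay k q +
        (q • (a ᵥ* C') + a ᵥ* C'' + q • (b ᵥ* C) + c) j • (Ay k q * Ax k q) := by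
  have hone (u : Fin n → k) : u j = ∑ i, u i * (1 : Matrix (Fin n) (Fin n) k) i j := by
    simp [Matrix.one_apply]
  rw [hone a]
  simp only [Pi.add_apply, Pi.smul_apply]
  rw [hone c]
  simp only [Matrix.vecMul, dotProduct, Finset.smul_sum, ← Finset.sum_add_distrib, Finset.sum_smul]
  refine Finset.sum_congr rfl fun i _ => ?_
  rw [phiMat_apply]
  simp only [mul_add, add_mul, smul_mul_assoc, mul_smul_comm, one_mul, Ax_mul_Ax,
    Ay_mul_Ay, Ax_mul_Ay_mul_Ax, Ay_mul_Ay_mul_Ax, Ay_mul_Ax_mul_Ax, Ay_mul_Ax_mul_Ay,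
    Ax_mul_Ay, ← mul_assoc (Ay k q * Ax k q), zero_mul, smul_zero]
  module

theorem range_imageParam (C C' C'' : Matrix (Fin n) (Fin n) k) {P : Matrix (Fin n) (Fin n) k}
    (hP : IsUnit P) :
    LinearMap.range (imageParam q C P) = imageM k q (phiMat k q C C' C'') := by
  have hsurj := Matrix.mulVec_surjective_iff_isUnit.2 hP
  apply le_antisymm
  · rintro _ ⟨v, rfl⟩
    refine Submodule.subset_span ⟨fun i => (P *ᵥ (v ∘ Sum.inr)) i • 1 + (0 : Fin n → k) i • Ax k q +
      (P *ᵥ (v ∘ Sum.inl) - q • ((P *ᵥ (v ∘ Sum.inr)) ᵥ* C') - (P *ᵥ (v ∘ Sum.inr)) ᵥ* C'') i •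
        Ay k q + (0 : Fin n → k) i • (Ay k q * Ax k q), funext fun j => ?_⟩
    simp only
    rw [vecMul_phiMat, imageParam_apply]
    congr 2
    simp
  · refine Submodule.span_le.2 ?_
    rintro _ ⟨u, rfl⟩
    choose a b c d h using fun i => Aalg.exists_coeffs k q (u i)
    obtain ⟨r, hr⟩ := hsurj a
    obtain ⟨l, hl⟩ := hsurj (q • (a ᵥ* C') + a ᵥ* C'' + q • (b ᵥ* C) + c)
    refine ⟨Sum.elim l r, funext fun j => ?_⟩
    obtain rfl := funext h
    simp only
    rw [vecMul_phiMat, imageParam_apply]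
    simp only [Sum.elim_comp_inl, Sum.elim_comp_inr, hr, hl]

theorem imageParam_x_action {C P : Matrix (Fin n) (Fin n) k} (h : Cᵀ * P = P * C)
    (v : Fin n ⊕ Fin n → k) :
    imageParam q C P (Matrix.fromBlocks 0 (q • C) 0 0 *ᵥ v) = Ax k q • imageParam q C P v := by
  ext i
  have hC : P *ᵥ (C *ᵥ (v ∘ Sum.inr)) = (P *ᵥ (v ∘ Sum.inr)) ᵥ* C := by
    rw [Matrix.mulVec_mulVec, ← h, ← Matrix.mulVec_mulVec, Matrix.mulVec_transpose]
  simp only [imageParam_apply, Matrix.fromBlocks_mulVec, Sum.elim_comp_inl, Sum.elim_comp_inr,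
    Pi.smul_apply, smul_eq_mul, mul_add, mul_smul_comm, Ax_mul_Ax, Ax_mul_Ay, Ax_mul_Ay_mul_Ax,
    Matrix.smul_mulVec, Matrix.zero_mulVec, Matrix.mulVec_zero, Matrix.zero_vecMul, zero_add,
    add_zero, Matrix.mulVec_smul, hC, Pi.zero_apply, zero_smul, smul_zero]
  module

theorem imageParam_y_action (C P : Matrix (Fin n) (Fin n) k) (v : Fin n ⊕ Fin n → k) :
    imageParam q C P (Matrix.fromBlocks 0 1 0 0 *ᵥ v) = Ay k q • imageParam q C P v := by
  ext i
  simp [imageParam_apply, Matrix.fromBlocks_mulVec, mul_add, Ay_mul_Ay, Ay_mul_Ay_mul_Ax]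

end Image

theorem stmt13 (k : Type*) [Field k] (q : k) (hq : q ≠ 0)
    (n : ℕ) (C C' C'' : Matrix (Fin n) (Fin n) k) (hC : IsUnit C) :
    Module.finrank k (imageM k q (phiMat k q C C' C'')) = 2 * n ∧
    ∃ e : (Fin n ⊕ Fin n → k) ≃ₗ[k] imageM k q (phiMat k q C C' C''),
      (∀ v : Fin n ⊕ Fin n → k,
        (e (Matrix.fromBlocks 0 (q • C) 0 0 *ᵥ v) : Fin n → Aalg k q) =
          Ax k q • (e v : Fin n → Aalg k q)) ∧
      (∀ v : Fin n ⊕ Fin n → k,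
        (e (Matrix.fromBlocks 0 1 0 0 *ᵥ v) : Fin n → Aalg k q) =
          Ay k q • (e v : Fin n → Aalg k q)) := by
  obtain ⟨P, hP, hPC⟩ := exists_isUnit_transpose_mul_eq_mul C
  let e := (LinearEquiv.ofInjective _ (imageParam_injective q C hP)).trans
    (LinearEquiv.ofEq _ _ (range_imageParam q C C' C'' hP))
  refine ⟨?_, e, imageParam_x_action q hPC, imageParam_y_action q C P⟩
  rw [← e.finrank_eq]
  simp [two_mul]
end
end
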